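/- Let (N, τ) be a tracial von Neumann algebra with von Neumann subalgebra B and conditional expectation E_B. Let Z₁,…,Z_m ∈ N be freely independent over B with E_B[Z_t] = 0 and ‖Z_t‖ ≤ K for all t. Then ‖Σ_{t=1}^m Z_t‖ ≤ (2√m + 1) K ≤ 3√m K. -/

import Mathlib

/-- Free independence with amalgamation over a subalgebra, with respect to a
conditional expectation `E`: alternating products of `E`-centered elements of the given
family of star-subalgebras are `E`-centered. -/
def FreelyIndependentOver {N : Type*} [Ring N] [StarRing N] [Algebra ℂ N] [StarModule ℂ N]
    {ι : Type*} (E : N →ₗ[ℂ] N) (A : ι → StarSubalgebra ℂ N) : Prop :=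
  ∀ (k : ℕ) (idx : Fin (k + 1) → ι),
    (∀ j : Fin k, idx j.castSucc ≠ idx j.succ) →
    ∀ x : Fin (k + 1) → N, (∀ j, x j ∈ A (idx j)) → (∀ j, E (x j) = 0) →
      E (List.ofFn x).prod = 0

section PreInnerProductSpace

variable {V ι : Type*} [SeminormedAddCommGroup V] [InnerProductSpace ℂ V] [Fintype ι]

/-- The Pythagorean theorem for finite sums of pairwise orthogonal vectors. -/
lemma norm_sum_sq_of_pairwise_inner_eq_zero (c : ι → V)
    (hc : ∀ i j, i ≠ j → inner ℂ (c i) (c j) = 0) :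
    ‖∑ i, c i‖ ^ 2 = ∑ i, ‖c i‖ ^ 2 := by
  classical
  have h : (inner ℂ (∑ i, c i) (∑ i, c i) : ℂ) = ∑ i, inner ℂ (c i) (c i) := by
    rw [sum_inner]
    refine Finset.sum_congr rfl fun i _ => ?_
    rw [inner_sum]
    exact Finset.sum_eq_single i (fun j _ hj => hc i j hj.symm) (by simp)
  have h' := congrArg Complex.re h
  rw [Complex.re_sum] at h'
  simpa only [← inner_self_eq_norm_sq (𝕜 := ℂ), RCLike.re_eq_complex_re] using h'

/-- A summand of an orthogonal sum, and the sum of the others, are no longer than the sum. -/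
lemma norm_le_and_norm_sub_le_of_pairwise_inner_eq_zero (c : ι → V)
    (hc : ∀ i j, i ≠ j → inner ℂ (c i) (c j) = 0) (i : ι) :
    ‖c i‖ ≤ ‖∑ j, c j‖ ∧ ‖∑ j, c j - c i‖ ≤ ‖∑ j, c j‖ := by
  classical
  have horth : inner ℂ (c i) (∑ j, c j - c i) = 0 := by
    rw [← Finset.sum_erase_eq_sub (Finset.mem_univ i), inner_sum]
    exact Finset.sum_eq_zero fun j hj => hc i j (Finset.ne_of_mem_erase hj).symm
  have h := norm_add_sq_eq_norm_sq_add_norm_sq_of_inner_eq_zero (𝕜 := ℂ) _ _ horth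
  rw [add_sub_cancel] at h
  constructor
  · nlinarith [norm_nonneg (c i), norm_nonneg (∑ j, c j), mul_self_nonneg ‖∑ j, c j - c i‖]
  · nlinarith [norm_nonneg (∑ j, c j - c i), norm_nonneg (∑ j, c j), mul_self_nonneg ‖c i‖]

lemma Submodule.exists_sum_eq_of_mem_iSup {R M : Type*} [Semiring R] [AddCommMonoid M]
    [Module R M] (H : ι → Submodule R M) {x : M} (hx : x ∈ ⨆ i, H i) :
    ∃ c : ι → M, (∀ i, c i ∈ H i) ∧ ∑ i, c i = x := by
  obtain ⟨f, hf, rfl⟩ := (Submodule.mem_iSup_iff_exists_finsupp H x).mp hx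
  exact ⟨f, hf, (Finsupp.sum_fintype f (fun _ x => x) fun _ => rfl).symm⟩

/-- If each `T t` sends every summand of an orthogonal sum other than the `t`-th into the `t`-th,
then `∑ t, T t` is bounded by `(2√m + 1) K` on that sum. -/
lemma norm_sum_apply_le_of_orthogonal (H : Option ι → Submodule ℂ V)
    (hH : ∀ i j, i ≠ j → ∀ x ∈ H i, ∀ y ∈ H j, inner ℂ x y = 0)
    (T : ι → V →ₗ[ℂ] V) {K : ℝ} (hK : 0 ≤ K) (hT : ∀ t v, ‖T t v‖ ≤ K * ‖v‖)
    (hne : ∀ t o, o ≠ some t → ∀ x ∈ H o, T t x ∈ H (some t))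
    (hself : ∀ t, ∀ x ∈ H (some t), T t x ∈ ⨆ o, H o) {v : V} (hv : v ∈ ⨆ o, H o) :
    ‖∑ t, T t v‖ ≤ (2 * √(Fintype.card ι) + 1) * K * ‖v‖ := by
  classical
  obtain ⟨c, hc, rfl⟩ := Submodule.exists_sum_eq_of_mem_iSup H hv
  choose d hd hdsum using fun t => Submodule.exists_sum_eq_of_mem_iSup H (hself t _ (hc (some t)))
  set v := ∑ o, c o
  have horth : ∀ w : Option ι → V, (∀ o, w o ∈ H o) → ∀ i j, i ≠ j → inner ℂ (w i) (w j) = 0 :=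
    fun w hw i j hij => hH i j hij _ (hw i) _ (hw j)
  have hcsq : ∑ t, ‖c (some t)‖ ^ 2 ≤ ‖v‖ ^ 2 := by
    rw [norm_sum_sq_of_pairwise_inner_eq_zero c (horth c hc), Fintype.sum_option]
    linarith [sq_nonneg ‖c none‖]
  have hoff : ∀ t, T t (v - c (some t)) ∈ H (some t) := fun t => by
    rw [← Finset.sum_erase_eq_sub (Finset.mem_univ _), map_sum]
    exact sum_mem fun o ho => hne t o (Finset.ne_of_mem_erase ho) _ (hc o)
  have hsplit : ∑ t, T t v = ∑ t, T t (v - c (some t)) + ∑ t, d t (some t)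
      + ∑ t, (T t (c (some t)) - d t (some t)) := by
    rw [← Finset.sum_add_distrib, ← Finset.sum_add_distrib]
    refine Finset.sum_congr rfl fun t _ => ?_
    rw [map_sub]; abel
  have hA : ‖∑ t, T t (v - c (some t))‖ ≤ √(Fintype.card ι) * K * ‖v‖ := by
    refine abs_le_of_sq_le_sq' ?_ (by positivity) |>.2
    rw [norm_sum_sq_of_pairwise_inner_eq_zero _ fun s t hst =>
      hH _ _ (by simpa using hst) _ (hoff s) _ (hoff t)]
    calc ∑ t, ‖T t (v - c (some t))‖ ^ 2 ≤ ∑ _t : ι, (K * ‖v‖) ^ 2 := by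
          gcongr with t
          refine (hT _ _).trans ?_
          gcongr
          exact (norm_le_and_norm_sub_le_of_pairwise_inner_eq_zero c (horth c hc) _).2
      _ = _ := by
          rw [mul_assoc, mul_pow √_, Real.sq_sqrt (by positivity)]
          simp
  have hB : ‖∑ t, d t (some t)‖ ≤ K * ‖v‖ := by
    refine abs_le_of_sq_le_sq' ?_ (by positivity) |>.2
    rw [norm_sum_sq_of_pairwise_inner_eq_zero _ fun s t hst =>
      hH _ _ (by simpa using hst) _ (hd s _) _ (hd t _)]
    calc ∑ t, ‖d t (some t)‖ ^ 2 ≤ ∑ t, (K * ‖c (some t)‖) ^ 2 := by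
          gcongr with t
          refine le_trans ?_ (hT t _)
          rw [← hdsum t]
          exact (norm_le_and_norm_sub_le_of_pairwise_inner_eq_zero _ (horth _ (hd t)) _).1
      _ ≤ _ := by
          simp_rw [mul_pow]
          rw [← Finset.mul_sum]
          gcongr
  have hC : ‖∑ t, (T t (c (some t)) - d t (some t))‖ ≤ √(Fintype.card ι) * K * ‖v‖ := by
    have hcs : ∑ t, ‖c (some t)‖ ≤ √(Fintype.card ι) * ‖v‖ := by
      refine abs_le_of_sq_le_sq' ?_ (by positivity) |>.2
      rw [mul_pow, Real.sq_sqrt (by positivity)]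
      refine (sq_sum_le_card_mul_sum_sq (s := Finset.univ)).trans ?_
      rw [Finset.card_univ]
      gcongr
    calc _ ≤ ∑ t, ‖T t (c (some t)) - d t (some t)‖ := norm_sum_le _ _
      _ ≤ ∑ t, K * ‖c (some t)‖ := by
          gcongr with t
          refine le_trans ?_ (hT t _)
          rw [← hdsum t]
          exact (norm_le_and_norm_sub_le_of_pairwise_inner_eq_zero _ (horth _ (hd t)) _).2
      _ = K * ∑ t, ‖c (some t)‖ := by rw [Finset.mul_sum]
      _ ≤ K * (√(Fintype.card ι) * ‖v‖) := by gcongr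
      _ = _ := by ring
  rw [hsplit]
  refine (norm_add₃_le).trans ?_
  linarith

end PreInnerProductSpace

section FaithfulState

open scoped ComplexOrder

variable {A : Type*} [CStarAlgebra A] [PartialOrder A] [StarOrderedRing A]

/-- The operator norm of `a` can be computed on the `L²`-closure, with respect to a faithful
positive functional, of any subspace that contains `1` and is invariant under `a` and `star a`. -/
lemma norm_le_of_faithful (f : A →ₚ[ℂ] ℂ) (hf : ∀ x, f (star x * x) = 0 → x = 0)
    (a : A) {C : ℝ} (hC : 0 ≤ C) (S : Submodule ℂ A) (h1 : 1 ∈ S)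
    (ha : ∀ y ∈ S, a * y ∈ S) (ha' : ∀ y ∈ S, star a * y ∈ S)
    (hbound : ∀ y ∈ S, ‖f.toPreGNS (a * y)‖ ≤ C * ‖f.toPreGNS y‖) : ‖a‖ ≤ C := by
  set h : A := star a * a - algebraMap ℝ A (C ^ 2) with h_def
  have hsa : IsSelfAdjoint h :=
    (IsSelfAdjoint.star_mul_self a).sub (.algebraMap A (IsSelfAdjoint.all _))
  have hhS : ∀ y ∈ S, h * y ∈ S := fun y hy => by
    rw [h_def, sub_mul, mul_assoc, Algebra.algebraMap_eq_smul_one, smul_one_mul]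
    exact sub_mem (ha' _ (ha _ hy)) (S.smul_of_tower_mem _ hy)
  have hmul : ∀ x ∈ StarAlgebra.adjoin ℝ {h}, ∀ y ∈ S, x * y ∈ S ∧ star x * y ∈ S := by
    intro x hx
    induction hx using StarAlgebra.adjoin_induction with
    | mem x hx =>
      rw [Set.mem_singleton_iff.mp hx, hsa.star_eq]
      exact fun y hy => ⟨hhS y hy, hhS y hy⟩
    | algebraMap r =>
      intro y hy
      rw [← algebraMap_star_comm, star_trivial, and_self, Algebra.algebraMap_eq_smul_one,
        smul_one_mul]
      exact S.smul_of_tower_mem _ hy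
    | add x y _ _ hx hy =>
      intro z hz
      rw [star_add, add_mul, add_mul]
      exact ⟨add_mem (hx z hz).1 (hy z hz).1, add_mem (hx z hz).2 (hy z hz).2⟩
    | mul x y _ _ hx hy =>
      intro z hz
      rw [star_mul, mul_assoc, mul_assoc]
      exact ⟨(hx _ (hy z hz).1).1, (hy _ (hx z hz).2).2⟩
    | star x _ hx =>
      intro y hy
      rw [star_star]
      exact (hx y hy).symm
  have hcont : Continuous fun y => (f (star y * h * y)).re := by
    have : Continuous f := map_continuous f
    fun_prop
  have hneg : ∀ y ∈ StarAlgebra.elemental ℝ h, (f (star y * h * y)).re ≤ 0 := by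
    refine fun y hy => closure_minimal (s := (StarAlgebra.adjoin ℝ {h} : Set A)) (fun y hy => ?_)
      (isClosed_le hcont continuous_const) hy
    have hyS : y ∈ S := by simpa using (hmul y hy 1 h1).1
    have key := pow_le_pow_left₀ (norm_nonneg _) (hbound y hyS) 2
    rw [mul_pow] at key
    have e1 := congrArg Complex.re (f.preGNS_norm_sq (f.toPreGNS (a * y)))
    have e2 := congrArg Complex.re (f.preGNS_norm_sq (f.toPreGNS y))
    simp only [f.ofPreGNS_toPreGNS, ← Complex.ofReal_pow, Complex.ofReal_re] at e1 e2
    have e3 : star y * h * y = star (a * y) * (a * y) - ((C ^ 2 : ℝ) : ℂ) • (star y * y) := by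
      rw [h_def, Algebra.algebraMap_eq_smul_one, Complex.coe_smul, star_mul]
      simp only [mul_sub, sub_mul, mul_assoc, smul_mul_assoc, one_mul, mul_smul_comm]
    simp only [Set.mem_ofPred_eq]
    rw [e3, map_sub, map_smul, smul_eq_mul, Complex.sub_re, Complex.re_ofReal_mul, ← e1, ← e2]
    linarith
  have hpos_mem : h⁺ ∈ StarAlgebra.elemental ℝ h := by
    rw [CFC.posPart_def,
      cfcₙ_eq_cfc (f := fun x : ℝ => x⁺) (hf := by fun_prop) (hf0 := posPart_zero)]
    exact cfc_mem_elemental _ _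
  have hp : 0 ≤ h⁺ := CFC.posPart_nonneg h
  have hpsa : star h⁺ = h⁺ := hp.isSelfAdjoint
  have hcube : star h⁺ * h * h⁺ = star h⁺ * h⁺ * h⁺ := by
    nth_rewrite 2 [← CFC.posPart_sub_negPart h hsa]
    rw [mul_sub, sub_mul, mul_assoc _ h⁻, CFC.negPart_mul_posPart]
    simp
  have hcube_nonneg : 0 ≤ star h⁺ * h⁺ * h⁺ := by
    rw [hpsa]
    nth_rewrite 1 [← hpsa]
    exact star_left_conjugate_nonneg hp _
  have hf0 : f (star h⁺ * h⁺ * h⁺) = 0 := by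
    have h0 := f.map_nonneg hcube_nonneg
    have h1 := hneg _ hpos_mem
    rw [hcube] at h1
    rw [Complex.nonneg_iff] at h0
    exact Complex.ext (le_antisymm h1 h0.1) h0.2.symm
  have hcube0 : star h⁺ * h⁺ * h⁺ = 0 := by
    obtain ⟨s, hs⟩ := CStarAlgebra.nonneg_iff_eq_star_mul_self.mp hcube_nonneg
    rw [hs] at hf0 ⊢
    rw [hf s hf0, mul_zero]
  have hsq0 : h⁺ * h⁺ = 0 := by
    rw [← CStarRing.star_mul_self_eq_zero_iff, star_mul, mul_assoc, ← mul_assoc _ _ (h⁺), hcube0,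
      mul_zero]
  have hp0 : h⁺ = 0 := by
    rwa [← CStarRing.star_mul_self_eq_zero_iff, hpsa]
  have hle : h ≤ 0 := (CFC.posPart_eq_zero_iff h hsa).mp hp0
  have := CStarAlgebra.norm_le_iff_le_algebraMap (star a * a) (sq_nonneg C)
    (star_mul_self_nonneg a) |>.mpr (sub_nonpos.mp hle)
  rw [CStarRing.norm_star_mul_self] at this
  exact abs_le_of_sq_le_sq' (by simpa [sq] using this) hC |>.2

end FaithfulState

section ReducedWords

variable {N ι : Type*} [Ring N] [StarRing N] [Algebra ℂ N] [StarModule ℂ N]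

/-- A list of letters `(t, x)` is reduced if neighbouring indices differ and each letter is an
`E`-centered element of the algebra with its index. -/
def IsReducedWord (E : N →ₗ[ℂ] N) (A : ι → StarSubalgebra ℂ N) (L : List (ι × N)) : Prop :=
  L.IsChain (fun p q => p.1 ≠ q.1) ∧ ∀ p ∈ L, p.2 ∈ A p.1 ∧ E p.2 = 0

/-- The span of the products of reduced words with first index `t`, or `B` for the index `none`. -/
def wordSpace (E : N →ₗ[ℂ] N) (B : StarSubalgebra ℂ N) (A : ι → StarSubalgebra ℂ N) :
    Option ι → Submodule ℂ N
  | none => B.toSubalgebra.toSubmodule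
  | some t => Submodule.span ℂ
      {y | ∃ x L, IsReducedWord E A ((t, x) :: L) ∧ (((t, x) :: L).map Prod.snd).prod = y}

variable {E : N →ₗ[ℂ] N} {A : ι → StarSubalgebra ℂ N}

lemma FreelyIndependentOver.apply_prod_eq_zero (hfree : FreelyIndependentOver E A)
    {L : List (ι × N)} (hL : IsReducedWord E A L) (hne : L ≠ []) :
    E (L.map Prod.snd).prod = 0 := by
  obtain ⟨p, L, rfl⟩ := List.exists_cons_of_ne_nil hne
  have h := hfree L.length (fun i => ((p :: L).get i).1)
    (fun j => List.isChain_iff_getElem.mp hL.1 j (by simp))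
    (fun i => ((p :: L).get i).2) (fun j => (hL.2 _ (List.get_mem _ _)).1)
    (fun j => (hL.2 _ (List.get_mem _ _)).2)
  have hmap : List.ofFn (fun i => ((p :: L).get i).2) = (p :: L).map Prod.snd := by
    conv_rhs => rw [← List.ofFn_get (p :: L), List.map_ofFn]
    rfl
  rwa [← hmap]

lemma isReducedWord_cons_cons {p q : ι × N} {L : List (ι × N)} :
    IsReducedWord E A (p :: q :: L) ↔
      p.1 ≠ q.1 ∧ (p.2 ∈ A p.1 ∧ E p.2 = 0) ∧ IsReducedWord E A (q :: L) := by
  simp only [IsReducedWord, List.isChain_cons_cons, List.forall_mem_cons (a := p)]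
  tauto

lemma isReducedWord_singleton {p : ι × N} :
    IsReducedWord E A [p] ↔ p.2 ∈ A p.1 ∧ E p.2 = 0 := by
  simp [IsReducedWord]

/-- Replacing the first letter of a reduced word by a centered element of the same algebra. -/
lemma IsReducedWord.replace_head {t : ι} {x y : N} {L : List (ι × N)}
    (hL : IsReducedWord E A ((t, x) :: L)) (hy : y ∈ A t) (hEy : E y = 0) :
    IsReducedWord E A ((t, y) :: L) := by
  cases L with
  | nil => exact isReducedWord_singleton.mpr ⟨hy, hEy⟩
  | cons q L =>
    rw [isReducedWord_cons_cons] at hL ⊢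
    exact ⟨hL.1, ⟨hy, hEy⟩, hL.2.2⟩

lemma IsReducedWord.head {p : ι × N} {L : List (ι × N)}
    (hL : IsReducedWord E A (p :: L)) : p.2 ∈ A p.1 ∧ E p.2 = 0 :=
  hL.2 p List.mem_cons_self

/-- The adjoint of a reduced word, as a reduced word. -/
lemma IsReducedWord.star_reverse (hstar : ∀ x, E x = 0 → E (star x) = 0) {L : List (ι × N)}
    (hL : IsReducedWord E A L) :
    IsReducedWord E A (L.map fun p => (p.1, star p.2)).reverse := by
  refine ⟨?_, ?_⟩
  · rw [List.isChain_reverse, List.isChain_map]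
    exact hL.1.imp fun _ _ h => h.symm
  · intro p hp
    rw [List.mem_reverse, List.mem_map] at hp
    obtain ⟨q, hq, rfl⟩ := hp
    exact ⟨star_mem (hL.2 q hq).1, hstar _ (hL.2 q hq).2⟩

lemma star_prod_map_snd {N ι : Type*} [Ring N] [StarRing N] (L : List (ι × N)) :
    star (L.map Prod.snd).prod = ((L.map fun p => (p.1, star p.2)).reverse.map Prod.snd).prod := by
  induction L with
  | nil => simp
  | cons p L ih => simp [ih]

variable {B : StarSubalgebra ℂ N}

lemma prod_mem_wordSpace {p : ι × N} {L : List (ι × N)} (hL : IsReducedWord E A (p :: L)) :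
    ((p :: L).map Prod.snd).prod ∈ wordSpace E B A (some p.1) :=
  Submodule.subset_span ⟨p.2, L, hL, rfl⟩

lemma wordSpace_some_induction {t : ι} {P : Submodule ℂ N} {g : N →ₗ[ℂ] N}
    (h : ∀ x L, IsReducedWord E A ((t, x) :: L) → g (x * (L.map Prod.snd).prod) ∈ P) {y : N}
    (hy : y ∈ wordSpace E B A (some t)) : g y ∈ P := by
  refine Submodule.span_le (p := P.comap g).mpr ?_ hy
  rintro _ ⟨x, L, hL, rfl⟩
  simpa using h x L hL

lemma map_mul_left_of_bimodule
    (hEbimod : ∀ b ∈ B, ∀ b' ∈ B, ∀ x : N, E (b * x * b') = b * E x * b') {b : N} (hb : b ∈ B)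
    (x : N) : E (b * x) = b * E x := by
  simpa using hEbimod b hb 1 (one_mem B) x

lemma map_mul_right_of_bimodule
    (hEbimod : ∀ b ∈ B, ∀ b' ∈ B, ∀ x : N, E (b * x * b') = b * E x * b') {b : N} (hb : b ∈ B)
    (x : N) : E (x * b) = E x * b := by
  simpa using hEbimod 1 (one_mem B) b hb x

lemma mul_mem_wordSpace_of_mem_base (hBA : ∀ t, B ≤ A t)
    (hEbimod : ∀ b ∈ B, ∀ b' ∈ B, ∀ x : N, E (b * x * b') = b * E x * b')
    {b : N} (hb : b ∈ B) {o : Option ι} {y : N} (hy : y ∈ wordSpace E B A o) :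
    b * y ∈ wordSpace E B A o := by
  cases o with
  | none => exact mul_mem (S := StarSubalgebra ℂ N) hb hy
  | some t =>
    refine wordSpace_some_induction (g := LinearMap.mulLeft ℂ b) (fun x L hL => ?_) hy
    have hw := prod_mem_wordSpace (B := B) (hL.replace_head (y := b * x)
      (mul_mem (hBA t hb) hL.head.1)
      (by rw [map_mul_left_of_bimodule hEbimod hb, hL.head.2, mul_zero]))
    simpa [mul_assoc] using hw

lemma mul_mem_wordSpace_of_ne (hBA : ∀ t, B ≤ A t)
    (hEbimod : ∀ b ∈ B, ∀ b' ∈ B, ∀ x : N, E (b * x * b') = b * E x * b')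
    {t : ι} {a : N} (ha : a ∈ A t) (hEa : E a = 0) {o : Option ι} (ho : o ≠ some t) {y : N}
    (hy : y ∈ wordSpace E B A o) : a * y ∈ wordSpace E B A (some t) := by
  cases o with
  | none =>
    have hy' : y ∈ B := hy
    have hw := prod_mem_wordSpace (B := B) (isReducedWord_singleton (E := E) (A := A)
      (p := (t, a * y)) |>.mpr ⟨mul_mem ha (hBA t hy'), by
        rw [map_mul_right_of_bimodule hEbimod hy', hEa, zero_mul]⟩)
    simpa using hw
  | some s =>
    refine wordSpace_some_induction (g := LinearMap.mulLeft ℂ a) (fun x L hL => ?_) hy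
    have hw := prod_mem_wordSpace (B := B) (isReducedWord_cons_cons (p := (t, a)) |>.mpr
      ⟨fun h => ho (congrArg some h.symm), ⟨ha, hEa⟩, hL⟩)
    simpa using hw

lemma mul_mem_iSup_wordSpace_of_self (hBA : ∀ t, B ≤ A t) (hEmem : ∀ x, E x ∈ B)
    (hEid : ∀ b ∈ B, E b = b)
    (hEbimod : ∀ b ∈ B, ∀ b' ∈ B, ∀ x : N, E (b * x * b') = b * E x * b')
    {t : ι} {a : N} (ha : a ∈ A t) {y : N} (hy : y ∈ wordSpace E B A (some t)) :
    a * y ∈ ⨆ o, wordSpace E B A o := by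
  refine wordSpace_some_induction (g := LinearMap.mulLeft ℂ a) (fun x L hL => ?_) hy
  have hb : E (a * x) ∈ B := hEmem _
  have hw := prod_mem_wordSpace (B := B) (hL.replace_head (y := a * x - E (a * x))
    (sub_mem (mul_mem ha hL.head.1) (hBA t hb)) (by rw [map_sub, hEid _ hb, sub_self]))
  have hsplit : a * (x * (L.map Prod.snd).prod) =
      (a * x - E (a * x)) * (L.map Prod.snd).prod + E (a * x) * (L.map Prod.snd).prod := by
    noncomm_ring
  rw [LinearMap.mulLeft_apply, hsplit]
  refine add_mem (Submodule.mem_iSup_of_mem (some t) (by simpa using hw)) ?_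
  cases L with
  | nil =>
    refine Submodule.mem_iSup_of_mem none ?_
    simpa [wordSpace] using hb
  | cons q L =>
    exact Submodule.mem_iSup_of_mem (some q.1) (mul_mem_wordSpace_of_mem_base hBA hEbimod hb
      (prod_mem_wordSpace (isReducedWord_cons_cons.mp hL).2.2))

lemma mul_mem_iSup_wordSpace (hBA : ∀ t, B ≤ A t) (hEmem : ∀ x, E x ∈ B)
    (hEid : ∀ b ∈ B, E b = b)
    (hEbimod : ∀ b ∈ B, ∀ b' ∈ B, ∀ x : N, E (b * x * b') = b * E x * b')
    {t : ι} {a : N} (ha : a ∈ A t) (hEa : E a = 0) {y : N} (hy : y ∈ ⨆ o, wordSpace E B A o) :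
    a * y ∈ ⨆ o, wordSpace E B A o := by
  refine iSup_le (a := (⨆ o, wordSpace E B A o).comap (LinearMap.mulLeft ℂ a))
    (fun o y hy => ?_) hy
  by_cases ho : o = some t
  · subst ho
    exact mul_mem_iSup_wordSpace_of_self hBA hEmem hEid hEbimod ha hy
  · exact Submodule.mem_iSup_of_mem _ (mul_mem_wordSpace_of_ne hBA hEbimod ha hEa ho hy)

lemma FreelyIndependentOver.apply_eq_zero_of_mem_wordSpace (hfree : FreelyIndependentOver E A)
    {t : ι} {y : N} (hy : y ∈ wordSpace E B A (some t)) : E y = 0 := by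
  refine (Submodule.mem_bot ℂ).mp
    (wordSpace_some_induction (P := ⊥) (g := E) (fun x L hL => ?_) hy)
  simpa using hfree.apply_prod_eq_zero hL (List.cons_ne_nil _ _)

/-- Word spaces with different indices are orthogonal for the `B`-valued inner product. -/
lemma FreelyIndependentOver.apply_star_mul_eq_zero (hfree : FreelyIndependentOver E A)
    (hEbimod : ∀ b ∈ B, ∀ b' ∈ B, ∀ x : N, E (b * x * b') = b * E x * b')
    (hstar : ∀ x, E x = 0 → E (star x) = 0) {o o' : Option ι} (ho : o ≠ o') {y z : N}
    (hy : y ∈ wordSpace E B A o) (hz : z ∈ wordSpace E B A o') : E (star y * z) = 0 := by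
  cases o with
  | none =>
    cases o' with
    | none => exact absurd rfl ho
    | some s =>
      rw [map_mul_left_of_bimodule hEbimod (star_mem (s := B) hy),
        hfree.apply_eq_zero_of_mem_wordSpace hz, mul_zero]
  | some t =>
    cases o' with
    | none =>
      rw [map_mul_right_of_bimodule hEbimod (b := z) hz,
        hstar _ (hfree.apply_eq_zero_of_mem_wordSpace hy), zero_mul]
    | some s =>
      have hts : t ≠ s := fun h => ho (congrArg some h)
      refine (Submodule.mem_bot ℂ).mp (wordSpace_some_induction (P := ⊥)
        (g := E ∘ₗ LinearMap.mulLeft ℂ (star y)) (fun x' L' hL' => ?_) hz)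
      have hy0 : E (star (x' * (L'.map Prod.snd).prod) * y) = 0 := by
        refine (Submodule.mem_bot ℂ).mp (wordSpace_some_induction (P := ⊥)
          (g := E ∘ₗ LinearMap.mulLeft ℂ _) (fun x L hL => ?_) hy)
        have hred : IsReducedWord E A
            ((((s, x') :: L').map fun p => (p.1, star p.2)).reverse ++ (t, x) :: L) := by
          have hrev := hL'.star_reverse hstar
          refine ⟨List.isChain_append.mpr ⟨hrev.1, hL.1, ?_⟩, ?_⟩
          · simp [hts.symm]
          · intro p hp
            rcases List.mem_append.mp hp with hp | hp
            · exact hrev.2 p hp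
            · exact hL.2 p hp
        have h0 := hfree.apply_prod_eq_zero hred (by simp)
        rw [List.map_append, List.prod_append, ← star_prod_map_snd] at h0
        simpa [mul_assoc] using h0
      simpa using hstar _ hy0

end ReducedWords

section ConditionalExpectation

open scoped ComplexOrder

/-- A conditional expectation that preserves a faithful positive functional sends adjoints of
centered elements to `0`. -/
lemma map_star_eq_zero_of_map_eq {A : Type*} [CStarAlgebra A] [PartialOrder A] [StarOrderedRing A]
    (f : A →ₚ[ℂ] ℂ) (hf : ∀ x, f (star x * x) = 0 → x = 0)
    {B : StarSubalgebra ℂ A} {E : A →ₗ[ℂ] A} (hEmem : ∀ x, E x ∈ B)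
    (hEbimod : ∀ b ∈ B, ∀ b' ∈ B, ∀ x, E (b * x * b') = b * E x * b')
    (hEf : ∀ x, f (E x) = f x) {x : A} (hx : E x = 0) : E (star x) = 0 := by
  apply hf
  have hb := hEmem (star x)
  rw [← map_mul_left_of_bimodule hEbimod (star_mem hb), hEf, ← star_star (E (star x)),
    ← star_mul, star_star, map_star, ← hEf, map_mul_right_of_bimodule hEbimod hb, hx]
  simp

/-- The operator norm bound for sums of elements that are free over a subalgebra. -/
lemma FreelyIndependentOver.norm_sum_le {A : Type*} [CStarAlgebra A] [PartialOrder A]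
    [StarOrderedRing A] {ι : Type*} [Fintype ι] (f : A →ₚ[ℂ] ℂ)
    (hf : ∀ x, f (star x * x) = 0 → x = 0)
    {B : StarSubalgebra ℂ A} {E : A →ₗ[ℂ] A} (hEmem : ∀ x, E x ∈ B) (hEid : ∀ b ∈ B, E b = b)
    (hEbimod : ∀ b ∈ B, ∀ b' ∈ B, ∀ x, E (b * x * b') = b * E x * b')
    (hEf : ∀ x, f (E x) = f x) {D : ι → StarSubalgebra ℂ A} (hBD : ∀ t, B ≤ D t)
    (hfree : FreelyIndependentOver E D) {Z : ι → A} (hZD : ∀ t, Z t ∈ D t)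
    (hcent : ∀ t, E (Z t) = 0) {K : ℝ} (hK : 0 ≤ K) (hbound : ∀ t, ‖Z t‖ ≤ K) :
    ‖∑ t, Z t‖ ≤ (2 * √(Fintype.card ι) + 1) * K := by
  have hstar : ∀ x, E x = 0 → E (star x) = 0 := fun x =>
    map_star_eq_zero_of_map_eq f hf hEmem hEbimod hEf
  refine norm_le_of_faithful f hf _ (by positivity) (⨆ o, wordSpace E B D o)
    (Submodule.mem_iSup_of_mem none (one_mem B)) (fun y hy => ?_) (fun y hy => ?_)
    (fun y hy => ?_)
  · rw [Finset.sum_mul]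
    exact sum_mem fun t _ => mul_mem_iSup_wordSpace hBD hEmem hEid hEbimod (hZD t) (hcent t) hy
  · rw [star_sum, Finset.sum_mul]
    exact sum_mem fun t _ => mul_mem_iSup_wordSpace hBD hEmem hEid hEbimod (star_mem (hZD t))
      (hstar _ (hcent t)) hy
  · have h := norm_sum_apply_le_of_orthogonal (V := f.PreGNS)
      (fun o => (wordSpace E B D o).comap f.ofPreGNS.toLinearMap)
      (fun i j hij x hx z hz => by
        rw [f.preGNS_inner_def, ← hEf]
        exact (congrArg f (hfree.apply_star_mul_eq_zero hEbimod hstar hij hx hz)).trans (map_zero f))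
      (fun t => (f.leftMulMapPreGNS (Z t)).toLinearMap) hK (fun t v => ?_)
      (fun t o ho x hx => mul_mem_wordSpace_of_ne hBD hEbimod (hZD t) (hcent t) ho hx)
      (fun t x hx => mul_mem_iSup_wordSpace_of_self hBD hEmem hEid hEbimod (hZD t) hx)
      (v := f.toPreGNS y) hy
    · rw [Finset.sum_mul, map_sum]
      exact h
    · refine ((f.leftMulMapPreGNS (Z t)).le_opNorm v).trans ?_
      gcongr
      exact (LinearMap.mkContinuous_norm_le _ (norm_nonneg _) _).trans (hbound t)

/-- Positivity on the elements `star a * a` makes a functional on a C⋆-algebra positive. -/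
lemma exists_positiveLinearMap_eq {A : Type*} [CStarAlgebra A] [PartialOrder A]
    [StarOrderedRing A] (τ : A →ₗ[ℂ] ℂ)
    (hτ : ∀ a, 0 ≤ (τ (star a * a)).re ∧ (τ (star a * a)).im = 0) :
    ∃ f : A →ₚ[ℂ] ℂ, ∀ x, f x = τ x := by
  refine ⟨.mk₀ τ fun x hx => ?_, fun _ => rfl⟩
  obtain ⟨s, rfl⟩ := CStarAlgebra.nonneg_iff_eq_star_mul_self.mp hx
  exact Complex.nonneg_iff.mpr ⟨(hτ s).1, (hτ s).2.symm⟩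

end ConditionalExpectation

/-- Voiculescu's operator-norm law of large numbers: if `Z₁,…,Z_m` are
freely independent over `B`, centered (`E_B[Z_t] = 0`) and uniformly bounded
(`‖Z_t‖ ≤ K`), then `‖Σ Z_t‖ ≤ (2√m + 1)K ≤ 3√m K`. -/
theorem stmt10
    {N : Type*} [NormedRing N] [StarRing N] [CStarRing N] [NormedAlgebra ℂ N]
    [StarModule ℂ N] [CompleteSpace N]
    (τ : N →ₗ[ℂ] ℂ)
    (hτ1 : τ 1 = 1)
    (hτtr : ∀ a b : N, τ (a * b) = τ (b * a))
    (hτpos : ∀ a : N, 0 ≤ (τ (star a * a)).re ∧ (τ (star a * a)).im = 0)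
    (hτfaith : ∀ a : N, τ (star a * a) = 0 → a = 0)
    (B : StarSubalgebra ℂ N) (E : N →ₗ[ℂ] N)
    -- E is the τ-preserving conditional expectation onto B
    (hEmem : ∀ x : N, E x ∈ B)
    (hEid : ∀ b ∈ B, E b = b)
    (hEbimod : ∀ b ∈ B, ∀ b' ∈ B, ∀ x : N, E (b * x * b') = b * E x * b')
    (hEpos : ∀ x : N, ∃ y : N, E (star x * x) = star y * y)
    (hEtr : ∀ x : N, τ (E x) = τ x)
    (m : ℕ) (hm : 1 ≤ m) (Z : Fin m → N) (K : ℝ)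
    (hcent : ∀ t, E (Z t) = 0)
    (hbound : ∀ t, ‖Z t‖ ≤ K)
    (hfree : FreelyIndependentOver E
      (fun t : Fin m => StarAlgebra.adjoin ℂ (insert (Z t) (B : Set N)))) :
    ‖∑ t, Z t‖ ≤ (2 * Real.sqrt m + 1) * K ∧
      (2 * Real.sqrt m + 1) * K ≤ 3 * Real.sqrt m * K := by
  have hK : 0 ≤ K := (norm_nonneg _).trans (hbound ⟨0, hm⟩)
  have hm' : 1 ≤ Real.sqrt m := Real.one_le_sqrt.mpr (by exact_mod_cast hm)
  refine ⟨?_, by nlinarith⟩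
  let _ : CStarAlgebra N := {}
  let _ := CStarAlgebra.spectralOrder N
  have _ := CStarAlgebra.spectralOrderedRing N
  obtain ⟨f, hf⟩ := exists_positiveLinearMap_eq τ hτpos
  have h := FreelyIndependentOver.norm_sum_le f (by simpa only [hf] using hτfaith) hEmem hEid
    hEbimod (by simpa only [hf] using hEtr)
    (fun t b hb => StarAlgebra.subset_adjoin ℂ _ (Set.mem_insert_of_mem _ hb)) hfree
    (fun t => StarAlgebra.subset_adjoin ℂ _ (Set.mem_insert _ _)) hcent hK hbound
  simpa using h
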